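/- arXiv:2502.11999 — 2 statements merged into one kernel-verified Lean document; each statement's English description precedes it below -/
import Mathlib

section
/- Let G = (V, E, w) be a finite directed graph with integer edge weights such that (i) w(e) ≥ −1 for every edge e ∈ E, (ii) every directed simple cycle C in G satisfies w(C) ≥ |C| (i.e., the minimum cycle mean of G is at least 1), and (iii) G is strongly connected. Let G_{≥0} denote the graph G with modified weights w_{≥0}(e) = max{w(e), 0}. Then κ(G) ≤ diam(G_{≥0}); that is, every directed simple path P in G with total weight w(P) ≤ 0 contains at most diam(G_{≥0}) edges of negative weight, where diam(G_{≥0}) is the maximum over ordered vertex pairs (u, v) of the minimum total w_{≥0}-weight of a directed walk from u to v. -/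
/-- `p` is a walk from `u` to `v` in the directed graph with edge relation `E`:
a nonempty sequence of vertices starting at `u`, ending at `v`, with consecutive
vertices joined by edges. -/
def IsWalkFrom {V : Type*} (E : V → V → Prop) (p : List V) (u v : V) : Prop :=
  p.Chain' E ∧ p.head? = some u ∧ p.getLast? = some v

/-- The total weight of a walk: the sum of `w` over consecutive pairs of vertices. -/
def walkWeight {V : Type*} (w : V → V → ℤ) (p : List V) : ℤ :=
  ((p.zip p.tail).map fun e => w e.1 e.2).sum

/-- `c` is a directed simple cycle: a nonempty list of pairwise distinct vertices
`v₀, …, v_{k-1}` such that the closed walk `v₀, …, v_{k-1}, v₀` uses only edges.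
The cycle has `c.length` edges. -/
def IsCycle {V : Type*} (E : V → V → Prop) (c : List V) : Prop :=
  c ≠ [] ∧ c.Nodup ∧ (c ++ c.take 1).Chain' E

/-- The total weight of a directed simple cycle. -/
def cycleWeight {V : Type*} (w : V → V → ℤ) (c : List V) : ℤ :=
  walkWeight w (c ++ c.take 1)

/-- The number of negative-weight edges on the walk `p`. -/
def negEdgeCount {V : Type*} (w : V → V → ℤ) (p : List V) : ℕ :=
  (p.zip p.tail).countP fun e => decide (w e.1 e.2 < 0)

/-- The shortest-walk distance from `u` to `v` with respect to the nonnegative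
weights `w_{≥0}(a,b) = max (w a b) 0`. -/
noncomputable def distGE0 {V : Type*} (E : V → V → Prop) (w : V → V → ℤ) (u v : V) : ℤ :=
  sInf {x : ℤ | ∃ p : List V, IsWalkFrom E p u v ∧
    walkWeight (fun a b => max (w a b) 0) p = x}

/-- The diameter of `G_{≥0}`: the maximum over ordered vertex pairs `(u, v)` of the
shortest-walk distance from `u` to `v` in `G_{≥0}`. -/
noncomputable def diamGE0 {V : Type*} (E : V → V → Prop) (w : V → V → ℤ) : ℤ :=
  sSup {x : ℤ | ∃ u v : V, distGE0 E w u v = x}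

/-- The weight of a walk through `y` is the sum of the weights of its two parts. -/
theorem walkWeight_append_cons {V : Type*} (w : V → V → ℤ) (a : List V) (y : V) (b : List V) :
    walkWeight w (a ++ y :: b) = walkWeight w (a ++ [y]) + walkWeight w (y :: b) := by
  induction a with
  | nil => simp [walkWeight]
  | cons x a ih =>
    cases a with
    | nil => simp [walkWeight]
    | cons z a =>
      simp only [walkWeight, List.cons_append, List.tail_cons, List.zip_cons_cons, List.map_cons,
        List.sum_cons] at ih ⊢
      rw [ih, add_assoc]

/-- A walk through `y` splits into its two parts. -/
theorem isChain_append_cons {V : Type*} {E : V → V → Prop} {a : List V} {y : V} {b : List V} :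
    (a ++ y :: b).IsChain E ↔ (a ++ [y]).IsChain E ∧ (y :: b).IsChain E :=
  List.isChain_split

theorem exists_eq_append_cons_append_cons_of_not_nodup {V : Type*} {l : List V}
    (h : ¬ l.Nodup) : ∃ (y : V) (a b d : List V), l = a ++ y :: (b ++ y :: d) := by
  induction l with
  | nil => simp at h
  | cons x l ih =>
    by_cases hx : x ∈ l
    · obtain ⟨b, d, rfl⟩ := List.append_of_mem hx
      exact ⟨x, [], b, d, rfl⟩
    · obtain ⟨y, a, b, d, rfl⟩ := ih fun hl => h (List.nodup_cons.2 ⟨hx, hl⟩)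
      exact ⟨y, x :: a, b, d, rfl⟩

/-- If every simple cycle has mean weight at least `1`, so does every closed walk. -/
theorem length_le_walkWeight_of_closed {V : Type*} {E : V → V → Prop} {w : V → V → ℤ}
    (hcyc : ∀ c : List V, IsCycle E c → (c.length : ℤ) ≤ cycleWeight w c) (x : V) (m : List V)
    (hm : (x :: (m ++ [x])).IsChain E) :
    (m.length : ℤ) + 1 ≤ walkWeight w (x :: (m ++ [x])) := by
  induction hn : m.length using Nat.strong_induction_on generalizing x m with
  | _ n ih =>
    subst hn
    by_cases hnd : (x :: m).Nodup
    · simpa [cycleWeight] using hcyc (x :: m) ⟨by simp, hnd, show List.IsChain E _ by simpa using hm⟩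
    obtain ⟨y, a, b, d, h⟩ := exists_eq_append_cons_append_cons_of_not_nodup hnd
    cases a with
    | nil =>
      obtain ⟨rfl, rfl⟩ : x = y ∧ m = b ++ y :: d := by simpa using h
      have e : x :: (b ++ x :: d ++ [x]) = (x :: b) ++ x :: (d ++ [x]) := by simp
      rw [e] at hm ⊢
      rw [isChain_append_cons] at hm
      rw [walkWeight_append_cons]
      have h₁ := ih b.length (by simp) x b hm.1 rfl
      have h₂ := ih d.length (by simp; omega) x d hm.2 rfl
      simp only [List.cons_append, List.length_append, List.length_cons] at h₁ h₂ ⊢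
      push_cast
      linarith
    | cons z a =>
      obtain ⟨rfl, rfl⟩ : x = z ∧ m = a ++ y :: (b ++ y :: d) := by simpa using h
      have e : x :: (a ++ y :: (b ++ y :: d) ++ [x]) =
          (x :: a) ++ y :: (b ++ y :: (d ++ [x])) := by simp
      rw [e] at hm ⊢
      rw [isChain_append_cons, ← List.cons_append (a := y), isChain_append_cons (a := y :: b)] at hm
      rw [walkWeight_append_cons, ← List.cons_append (a := y) (as := b) (bs := y :: (d ++ [x])),
        walkWeight_append_cons w (y :: b)]
      have h₁ := ih b.length (by simp; omega) y b hm.2.1 rfl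
      have h₂ := ih (a ++ y :: d).length (by simp) x (a ++ y :: d)
        (by simpa using isChain_append_cons.2 ⟨hm.1, hm.2.2⟩) rfl
      have e' : x :: (a ++ y :: d ++ [x]) = (x :: a) ++ y :: (d ++ [x]) := by simp
      rw [e', walkWeight_append_cons] at h₂
      simp only [List.cons_append, List.length_append, List.length_cons] at h₁ h₂ ⊢
      push_cast at h₂ ⊢
      linarith

theorem walkWeight_le_walkWeight_max {V : Type*} (w : V → V → ℤ) (p : List V) :
    walkWeight w p ≤ walkWeight (fun a b => max (w a b) 0) p :=
  List.sum_le_sum fun _ _ => le_max_left _ _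

theorem walkWeight_max_nonneg {V : Type*} (w : V → V → ℤ) (p : List V) :
    0 ≤ walkWeight (fun a b => max (w a b) 0) p :=
  List.sum_nonneg (by simp only [List.mem_map]; rintro _ ⟨e, -, rfl⟩; exact le_max_right _ _)

theorem negEdgeCount_le {V : Type*} (w : V → V → ℤ) (p : List V) :
    negEdgeCount w p ≤ p.length - 1 :=
  List.countP_le_length.trans (by simp)

/-- A return walk for a walk of nonpositive weight weighs at least the number of negative edges
of that walk. -/
theorem negEdgeCount_le_walkWeight_max {V : Type*} {E : V → V → Prop} {w : V → V → ℤ}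
    (hcyc : ∀ c : List V, IsCycle E c → (c.length : ℤ) ≤ cycleWeight w c)
    {p q : List V} {u v : V} (hp : IsWalkFrom E p u v) (hq : IsWalkFrom E q v u)
    (hwp : walkWeight w p ≤ 0) :
    (negEdgeCount w p : ℤ) ≤ walkWeight (fun a b => max (w a b) 0) q := by
  obtain ⟨hpc, hpu, hpv⟩ := hp
  obtain ⟨hqc, hqv, hqu⟩ := hq
  change p.IsChain E at hpc
  change q.IsChain E at hqc
  have hneg := negEdgeCount_le w p
  have hq0 := walkWeight_max_nonneg w q
  have hqw := walkWeight_le_walkWeight_max w q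
  cases p with
  | nil => simp at hpu
  | cons p₀ p =>
    obtain rfl : p₀ = u := by simpa using hpu
    rcases List.eq_nil_or_concat p with rfl | ⟨m, p₁, rfl⟩
    · simp at hneg
      omega
    obtain rfl : p₁ = v := by simpa [List.getLast?_cons] using hpv
    cases q with
    | nil => simp at hqv
    | cons q₀ q =>
      obtain rfl : q₀ = p₁ := by simpa using hqv
      rcases List.eq_nil_or_concat q with rfl | ⟨n, q₁, rfl⟩
      · obtain rfl : q₀ = p₀ := by simpa using hqu
        have h := length_le_walkWeight_of_closed hcyc q₀ m (by simpa using hpc)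
        simp at h hwp
        omega
      · obtain rfl : q₁ = p₀ := by simpa [List.getLast?_cons] using hqu
        have e : q₁ :: (m ++ q₀ :: n ++ [q₁]) = (q₁ :: m) ++ q₀ :: (n ++ [q₁]) := by simp
        have h := length_le_walkWeight_of_closed hcyc q₁ (m ++ q₀ :: n)
          (by rw [e]; exact isChain_append_cons.2 ⟨by simpa using hpc, by simpa using hqc⟩)
        rw [e, walkWeight_append_cons] at h
        simp at h hwp hqw hneg ⊢
        omega


/-- Diameter upper bound on κ: for a finite, strongly connected
directed graph with all weights ≥ -1 and minimum cycle mean at least 1, every simple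
path of nonpositive total weight contains at most `diam(G_{≥0})` negative edges. -/
theorem kappa_le_diamGE0 {V : Type*} [Fintype V]
    (E : V → V → Prop) (w : V → V → ℤ)
    (hw : ∀ u v : V, E u v → -1 ≤ w u v)
    (hcyc : ∀ c : List V, IsCycle E c → (c.length : ℤ) ≤ cycleWeight w c)
    (hsc : ∀ u v : V, ∃ p : List V, IsWalkFrom E p u v) :
    ∀ (p : List V) (u v : V), IsWalkFrom E p u v → p.Nodup → walkWeight w p ≤ 0 →
      (negEdgeCount w p : ℤ) ≤ diamGE0 E w := by
  intro p u v hp _ hwp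
  have hdist : (negEdgeCount w p : ℤ) ≤ distGE0 E w v u := by
    obtain ⟨q, hq⟩ := hsc v u
    refine le_csInf ⟨_, q, hq, rfl⟩ ?_
    rintro _ ⟨q, hq, rfl⟩
    exact negEdgeCount_le_walkWeight_max hcyc hp hq hwp
  have hfin : {x : ℤ | ∃ u v : V, distGE0 E w u v = x}.Finite :=
    (Set.finite_range fun e : V × V => distGE0 E w e.1 e.2).subset <| by
      rintro _ ⟨u, v, rfl⟩
      exact ⟨(u, v), rfl⟩
  exact hdist.trans (le_csSup hfin.bddAbove ⟨v, u, rfl⟩)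
end

section
/- Correctness of FixDAGEdges: Let G = (V, E, w) be a finite directed graph with integer edge weights, let φ : V → ℤ, and let c : V → {1, …, ℓ} assign to each vertex the index of its component, such that: (a) for every edge (u, v) ∈ E one has c(u) ≤ c(v) (the components are topologically ordered), and (b) for every edge (u, v) ∈ E with c(u) = c(v) the reduced weight w(u, v) + φ(u) − φ(v) is nonnegative. Set M = min{0, min over (u,v) ∈ E of (w(u, v) + φ(u) − φ(v))} − 1 and define φ'(v) = φ(v) + c(v) · M for all v ∈ V. Then φ' is a valid potential function: w(u, v) + φ'(u) − φ'(v) ≥ 0 for every edge (u, v) ∈ E. -/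
/-- correctness of FixDAGEdges: given a component labeling
`c : V → {1, …, ℓ}` which is topologically ordered (`c u ≤ c v` along every edge) and
such that intra-component edges have nonnegative reduced weight w.r.t. `φ`, setting
`M = min {0, min over edges of the reduced weight} - 1` and `φ'(v) = φ(v) + c(v) · M`
yields a valid potential function: every edge has nonnegative reduced weight w.r.t. `φ'`. -/
theorem fixDAGEdges_correct {V : Type*} [Fintype V]
    (E : V → V → Prop) [DecidablePred fun e : V × V => E e.1 e.2]
    (w : V → V → ℤ) (φ : V → ℤ)
    (ℓ : ℕ) (hℓ : 1 ≤ ℓ)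
    (c : V → ℕ) (hc : ∀ x : V, 1 ≤ c x ∧ c x ≤ ℓ)
    (htopo : ∀ u v : V, E u v → c u ≤ c v)
    (hintra : ∀ u v : V, E u v → c u = c v → 0 ≤ w u v + φ u - φ v)
    (hE : (Finset.univ.filter fun e : V × V => E e.1 e.2).Nonempty)
    (M : ℤ)
    (hM : M = min 0 ((Finset.univ.filter fun e : V × V => E e.1 e.2).inf' hE
        fun e => w e.1 e.2 + φ e.1 - φ e.2) - 1) :
    ∀ u v : V, E u v →
      0 ≤ w u v + (φ u + (c u : ℤ) * M) - (φ v + (c v : ℤ) * M) := by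
  intro u v huv
  have hmin : (Finset.univ.filter fun e : V × V => E e.1 e.2).inf' hE
      (fun e => w e.1 e.2 + φ e.1 - φ e.2) ≤ w u v + φ u - φ v :=
    Finset.inf'_le (fun e : V × V => w e.1 e.2 + φ e.1 - φ e.2)
      (Finset.mem_filter.2 ⟨Finset.mem_univ (u, v), huv⟩)
  have hM_nonpos : M ≤ 0 := by
    rw [hM]
    linarith [min_le_left (0 : ℤ) ((Finset.univ.filter fun e : V × V => E e.1 e.2).inf' hE
      fun e => w e.1 e.2 + φ e.1 - φ e.2)]
  have hM_le : M ≤ w u v + φ u - φ v := by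
    rw [hM]
    linarith [min_le_right (0 : ℤ) ((Finset.univ.filter fun e : V × V => E e.1 e.2).inf' hE
      fun e => w e.1 e.2 + φ e.1 - φ e.2)]
  rcases (htopo u v huv).eq_or_lt with h | h
  · rw [h]
    linarith [hintra u v huv h]
  · have hgap : (c u : ℤ) + 1 ≤ c v := by exact_mod_cast h
    nlinarith [mul_nonneg (sub_nonneg.2 hgap) (neg_nonneg.2 hM_nonpos)]
end
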